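/- arXiv:2402.15315 — 2 statements merged into one kernel-verified Lean document; each statement's English description precedes it below -/
import Mathlib

section
/- Let f₁, f₂ : ℝⁿ → ℝ be CPWL functions with minimal depths m₁ and m₂ respectively. If m₁ ≠ m₂, then f₁ + f₂ has minimal depth max(m₁, m₂). -/
open Pointwise

noncomputable section

/-- `NN m n` is the set of functions `ℝⁿ → ℝ` representable by a ReLU neural network
with `m` hidden layers: `f = T⁽ᵐ⁺¹⁾ ∘ σ ∘ T⁽ᵐ⁾ ∘ σ ∘ ⋯ ∘ σ ∘ T⁽¹⁾` with each `T⁽ˡ⁾` affine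
and `σ` the componentwise ReLU.  (`NN 0 n` is the set of affine functions.) -/
def NN : ℕ → (n : ℕ) → Set ((Fin n → ℝ) → ℝ)
  | 0, n => {f | ∃ T : (Fin n → ℝ) →ᵃ[ℝ] ℝ, f = ⇑T}
  | m + 1, n => {f | ∃ (w : ℕ) (T : (Fin n → ℝ) →ᵃ[ℝ] (Fin w → ℝ)),
      ∃ g ∈ NN m w, f = fun x => g fun i => max (T x i) 0}

/-- Continuous piecewise linear functions `ℝⁿ → ℝ`: continuous functions that at each point
agree with one of finitely many affine functions. -/
def CPWL (n : ℕ) : Set ((Fin n → ℝ) → ℝ) :=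
  {f | Continuous f ∧ ∃ s : Finset ((Fin n → ℝ) →ᵃ[ℝ] ℝ), ∀ x, ∃ g ∈ s, f x = g x}

/-- `f` has minimal depth `m`: `f ∈ Υₙ(m)` and either `m = 0` or `f ∉ Υₙ(m-1)`. -/
def MinDepth (n : ℕ) (f : (Fin n → ℝ) → ℝ) (m : ℕ) : Prop :=
  f ∈ NN m n ∧ (m = 0 ∨ f ∉ NN (m - 1) n)

/-- `Mn n` is the least `m` such that `Υₙ = Υₙ(m)`. -/
def Mn (n : ℕ) : ℕ := sInf {m | CPWL n = NN m n}

/-- Network functions are stable under precomposition with affine maps. -/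
theorem NN_comp_affine {m n k : ℕ} {f : (Fin n → ℝ) → ℝ} (hf : f ∈ NN m n)
    (A : (Fin k → ℝ) →ᵃ[ℝ] (Fin n → ℝ)) : (fun x => f (A x)) ∈ NN m k := by
  cases m with
  | zero =>
    obtain ⟨T, rfl⟩ := hf
    exact ⟨T.comp A, rfl⟩
  | succ m =>
    obtain ⟨w, T, g, hg, rfl⟩ := hf
    exact ⟨w, T.comp A, g, hg, rfl⟩

theorem NN_neg {m n : ℕ} {f : (Fin n → ℝ) → ℝ} (hf : f ∈ NN m n) : -f ∈ NN m n := by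
  induction m generalizing n with
  | zero =>
    obtain ⟨T, rfl⟩ := hf
    exact ⟨-T, rfl⟩
  | succ m ih =>
    obtain ⟨w, T, g, hg, rfl⟩ := hf
    exact ⟨w, T, -g, ih hg, rfl⟩

theorem NN_add {m n : ℕ} {f g : (Fin n → ℝ) → ℝ} (hf : f ∈ NN m n) (hg : g ∈ NN m n) :
    f + g ∈ NN m n := by
  induction m generalizing n with
  | zero =>
    obtain ⟨T, rfl⟩ := hf
    obtain ⟨S, rfl⟩ := hg
    exact ⟨T + S, rfl⟩
  | succ m ih =>
    obtain ⟨a, T, f, hf, rfl⟩ := hf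
    obtain ⟨b, S, g, hg, rfl⟩ := hg
    refine ⟨a + b, AffineMap.pi (Fin.addCases
      (fun i => (LinearMap.proj (R := ℝ) (φ := fun _ : Fin a => ℝ) i).toAffineMap.comp T)
      (fun i => (LinearMap.proj (R := ℝ) (φ := fun _ : Fin b => ℝ) i).toAffineMap.comp S)), _,
      ih (NN_comp_affine hf (LinearMap.funLeft ℝ ℝ (Fin.castAdd b)).toAffineMap)
        (NN_comp_affine hg (LinearMap.funLeft ℝ ℝ (Fin.natAdd a)).toAffineMap), ?_⟩
    funext x
    simp [LinearMap.funLeft, Function.comp_def]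

theorem NN_subset_succ (m n : ℕ) : NN m n ⊆ NN (m + 1) n := by
  intro f hf
  induction m generalizing n with
  | zero =>
    obtain ⟨T, rfl⟩ := hf
    refine ⟨2, AffineMap.pi ![T, -T], _,
      ⟨(LinearMap.proj (R := ℝ) (φ := fun _ : Fin 2 => ℝ) 0
        - LinearMap.proj (R := ℝ) (φ := fun _ : Fin 2 => ℝ) 1).toAffineMap, rfl⟩, ?_⟩
    funext x
    simp
  | succ m ih =>
    obtain ⟨w, T, g, hg, rfl⟩ := hf
    exact ⟨w, T, g, ih w hg, rfl⟩

theorem NN_mono (n : ℕ) : Monotone fun m => NN m n :=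
  monotone_nat_of_le_succ fun m => NN_subset_succ m n

theorem MinDepth_add_of_lt {n m₁ m₂ : ℕ} {f₁ f₂ : (Fin n → ℝ) → ℝ}
    (hm₁ : MinDepth n f₁ m₁) (hm₂ : MinDepth n f₂ m₂) (hlt : m₁ < m₂) :
    MinDepth n (f₁ + f₂) m₂ := by
  refine ⟨NN_add (NN_mono n hlt.le hm₁.1) hm₂.1, Or.inr fun h => ?_⟩
  refine hm₂.2.elim (by omega) fun h₂ => h₂ ?_
  have hf₁ : f₁ ∈ NN (m₂ - 1) n := NN_mono n (show m₁ ≤ m₂ - 1 by omega) hm₁.1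
  simpa using NN_add (NN_neg hf₁) h

/-- If `f₁, f₂` are CPWL with minimal depths `m₁ ≠ m₂`, then `f₁ + f₂` has
minimal depth `max m₁ m₂`. -/
theorem statement2 (n m₁ m₂ : ℕ) (f₁ f₂ : (Fin n → ℝ) → ℝ)
    (h₁ : f₁ ∈ CPWL n) (h₂ : f₂ ∈ CPWL n)
    (hm₁ : MinDepth n f₁ m₁) (hm₂ : MinDepth n f₂ m₂) (hne : m₁ ≠ m₂) :
    MinDepth n (f₁ + f₂) (max m₁ m₂) := by
  rcases lt_or_gt_of_ne hne with h | h
  · rw [max_eq_right h.le]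
    exact MinDepth_add_of_lt hm₁ hm₂ h
  · rw [max_eq_left h.le, add_comm]
    exact MinDepth_add_of_lt hm₂ hm₁ h
end
end

section
/- Suppose that for some m₂ with 1 < m₂ ≤ M_n there exists a CPWL function f : ℝⁿ → ℝ with minimal depth m₂ such that f ≤ 0 everywhere and f has compact support. Then for every m₁ with 1 ≤ m₁ < m₂ there exist CPWL functions f₁, f₂ : ℝⁿ → ℝ with minimal depths m₁ and m₂ respectively such that max(f₁, f₂) = 0 (the pointwise maximum is the zero function). -/
open Pointwise

noncomputable section

namespace NN

theorem comp_affine {m n k : ℕ} {f : (Fin n → ℝ) → ℝ} (hf : f ∈ NN m n)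
    (A : (Fin k → ℝ) →ᵃ[ℝ] (Fin n → ℝ)) : (fun x => f (A x)) ∈ NN m k := by
  cases m with
  | zero =>
    obtain ⟨T, rfl⟩ := hf
    exact ⟨T.comp A, rfl⟩
  | succ m =>
    obtain ⟨w, T, g, hg, rfl⟩ := hf
    exact ⟨w, T.comp A, g, hg, rfl⟩

theorem const_mul {m n : ℕ} {f : (Fin n → ℝ) → ℝ} (hf : f ∈ NN m n) (c : ℝ) :
    (fun x => c * f x) ∈ NN m n := by
  induction m generalizing n with
  | zero =>
    obtain ⟨T, rfl⟩ := hf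
    exact ⟨c • T, rfl⟩
  | succ m ih =>
    obtain ⟨w, T, g, hg, rfl⟩ := hf
    exact ⟨w, T, _, ih hg, rfl⟩

theorem const (m n : ℕ) (b : ℝ) : (fun _ => b) ∈ NN m n := by
  induction m generalizing n with
  | zero => exact ⟨AffineMap.const ℝ _ b, rfl⟩
  | succ m ih => exact ⟨0, AffineMap.const ℝ _ 0, _, ih 0, rfl⟩

theorem add {m n : ℕ} {f g : (Fin n → ℝ) → ℝ} (hf : f ∈ NN m n) (hg : g ∈ NN m n) :
    (fun x => f x + g x) ∈ NN m n := by
  induction m generalizing n with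
  | zero =>
    obtain ⟨T, rfl⟩ := hf
    obtain ⟨S, rfl⟩ := hg
    exact ⟨T + S, rfl⟩
  | succ m ih =>
    obtain ⟨w, T, p, hp, rfl⟩ := hf
    obtain ⟨v, S, q, hq, rfl⟩ := hg
    refine ⟨w + v, AffineMap.pi (Fin.append
      (fun i => (LinearMap.proj (R := ℝ) (φ := fun _ : Fin w => ℝ) i).toAffineMap.comp T)
      (fun i => (LinearMap.proj (R := ℝ) (φ := fun _ : Fin v => ℝ) i).toAffineMap.comp S)), _,
      ih (comp_affine hp (LinearMap.funLeft ℝ ℝ (Fin.castAdd v)).toAffineMap)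
        (comp_affine hq (LinearMap.funLeft ℝ ℝ (Fin.natAdd w)).toAffineMap), ?_⟩
    funext x
    simp [LinearMap.funLeft, Function.comp_def]

theorem sum {ι : Type*} {m n : ℕ} (s : Finset ι) {f : ι → (Fin n → ℝ) → ℝ}
    (hf : ∀ i, f i ∈ NN m n) : (fun x => ∑ i ∈ s, f i x) ∈ NN m n := by
  classical
  induction s using Finset.induction_on with
  | empty => simpa using const m n 0
  | insert a s ha ih => simpa [Finset.sum_insert ha] using add (hf a) ih

theorem relu {m n : ℕ} {f : (Fin n → ℝ) → ℝ} (hf : f ∈ NN m n) :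
    (fun x => max (f x) 0) ∈ NN (m + 1) n := by
  induction m generalizing n with
  | zero =>
    obtain ⟨T, rfl⟩ := hf
    exact ⟨1, AffineMap.pi fun _ => T, fun y => y 0,
      ⟨(LinearMap.proj (R := ℝ) (φ := fun _ : Fin 1 => ℝ) 0).toAffineMap, rfl⟩, rfl⟩
  | succ m ih =>
    obtain ⟨w, T, g, hg, rfl⟩ := hf
    exact ⟨w, T, _, ih hg, rfl⟩

theorem subset_succ (m n : ℕ) : NN m n ⊆ NN (m + 1) n := by
  intro f hf
  convert add (relu hf) (const_mul (relu (const_mul hf (-1))) (-1)) using 2 with x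
  rcases le_total (f x) 0 with h | h
  · rw [max_eq_right h, max_eq_left (by linarith)]; ring
  · rw [max_eq_left h, max_eq_right (by linarith)]; ring

theorem monotone_depth (n : ℕ) : Monotone fun m => NN m n :=
  monotone_nat_of_le_succ fun m => subset_succ m n

/-- A network with `m + 1` hidden layers is an affine combination of rectified networks with
`m` hidden layers. -/
theorem exists_eq_sum_relu {m n : ℕ} {f : (Fin n → ℝ) → ℝ} (hf : f ∈ NN (m + 1) n) :
    ∃ (w : ℕ) (b : ℝ) (c : Fin w → ℝ) (h : Fin w → (Fin n → ℝ) → ℝ),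
      (∀ i, h i ∈ NN m n) ∧ f = fun x => b + ∑ i, c i * max (h i x) 0 := by
  induction m generalizing n with
  | zero =>
    obtain ⟨w, T, g, ⟨S, rfl⟩, rfl⟩ := hf
    refine ⟨w, S 0, fun i => S.linear (Pi.single i 1), fun i x => T x i, fun i =>
      ⟨(LinearMap.proj (R := ℝ) (φ := fun _ : Fin w => ℝ) i).toAffineMap.comp T, rfl⟩, ?_⟩
    funext x
    have key (y : Fin w → ℝ) : S y = S 0 + ∑ i, S.linear (Pi.single i 1) * y i := by
      have hS : S y = S.linear y + S 0 := by simpa using S.map_vadd 0 y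
      rw [hS, LinearMap.pi_apply_eq_sum_univ S.linear y, add_comm]
      congr 1
      refine Finset.sum_congr rfl fun i _ => ?_
      rw [smul_eq_mul, mul_comm]
      congr 2
      funext j
      simp [Pi.single_apply, eq_comm]
    exact key _
  | succ m ih =>
    obtain ⟨w, T, g, hg, rfl⟩ := hf
    obtain ⟨v, b, c, h, hh, rfl⟩ := ih hg
    exact ⟨v, b, c, _, fun i => ⟨w, T, h i, hh i, rfl⟩, rfl⟩

theorem succ_subset_of_relu {m k n : ℕ}
    (H : ∀ h ∈ NN m n, (fun x => max (h x) 0) ∈ NN k n) : NN (m + 1) n ⊆ NN k n := by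
  intro f hf
  obtain ⟨w, b, c, h, hh, rfl⟩ := exists_eq_sum_relu hf
  exact add (const k n b) (sum _ fun i => const_mul (H _ (hh i)) (c i))

/-- If rectification does not leave depth `k`, then the depth hierarchy is constant from `k` on. -/
theorem add_subset_of_relu {k n : ℕ}
    (H : ∀ h ∈ NN k n, (fun x => max (h x) 0) ∈ NN k n) (j : ℕ) : NN (k + j) n ⊆ NN k n := by
  induction j with
  | zero => exact subset_rfl
  | succ j ih => exact succ_subset_of_relu fun h hh => H h (ih hh)

theorem subset_CPWL (m n : ℕ) : NN m n ⊆ CPWL n := by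
  classical
  intro f hf
  induction m generalizing n with
  | zero =>
    obtain ⟨T, rfl⟩ := hf
    exact ⟨T.continuous_of_finiteDimensional, {T}, fun x => ⟨T, by simp, rfl⟩⟩
  | succ m ih =>
    obtain ⟨w, T, g, hg, rfl⟩ := hf
    obtain ⟨hc, s, hs⟩ := ih w hg
    have hT := T.continuous_of_finiteDimensional
    refine ⟨hc.comp (by fun_prop), ?_⟩
    let restrict (S : Finset (Fin w)) : (Fin n → ℝ) →ᵃ[ℝ] (Fin w → ℝ) := AffineMap.pi fun i =>
      if i ∈ S then (LinearMap.proj (R := ℝ) (φ := fun _ : Fin w => ℝ) i).toAffineMap.comp T else 0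
    refine ⟨Finset.image₂ (fun G S => G.comp (restrict S)) s Finset.univ, fun x => ?_⟩
    obtain ⟨G, hG, hGx⟩ := hs fun i => max (T x i) 0
    refine ⟨_, Finset.mem_image₂_of_mem hG
      (Finset.mem_univ (Finset.univ.filter fun i => 0 ≤ T x i)), hGx.trans ?_⟩
    simp only [AffineMap.comp_apply]
    congr 1
    funext i
    by_cases hi : 0 ≤ T x i
    · simp [restrict, hi]
    · simp [restrict, hi, le_of_not_ge hi]

end NN

/-- If for some `1 < m₂ ≤ Mₙ` there is a nonpositive CPWL function of minimal
depth `m₂` with compact support, then for every `1 ≤ m₁ < m₂` there are CPWL `f₁, f₂` of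
minimal depths `m₁, m₂` with `max (f₁, f₂) = 0`. -/
theorem statement9 (n m₂ : ℕ) (h1 : 1 < m₂) (h2 : m₂ ≤ Mn n)
    (f : (Fin n → ℝ) → ℝ) (hf : f ∈ CPWL n) (hmin : MinDepth n f m₂)
    (hneg : ∀ x, f x ≤ 0) (hsupp : HasCompactSupport f) :
    ∀ m₁, 1 ≤ m₁ → m₁ < m₂ →
      ∃ f₁ f₂ : (Fin n → ℝ) → ℝ, f₁ ∈ CPWL n ∧ f₂ ∈ CPWL n ∧
        MinDepth n f₁ m₁ ∧ MinDepth n f₂ m₂ ∧ ∀ x, max (f₁ x) (f₂ x) = 0 := by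
  intro m₁ hm₁ hlt
  obtain ⟨k, rfl⟩ : ∃ k, m₁ = k + 1 := ⟨m₁ - 1, by omega⟩
  obtain ⟨hfm, hfn⟩ := hmin
  replace hfn := hfn.resolve_left (by omega)
  obtain ⟨h, hh, hrelu⟩ : ∃ h ∈ NN k n, (fun x => max (h x) 0) ∉ NN k n := by
    by_contra! H
    have hsub := NN.add_subset_of_relu H (m₂ - k)
    rw [Nat.add_sub_cancel' (by omega)] at hsub
    exact hfn (NN.monotone_depth n (by omega : k ≤ m₂ - 1) (hsub hfm))
  obtain ⟨x₀, hx₀⟩ : ∃ x₀, h x₀ < 0 := by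
    by_contra! H
    exact hrelu (by simpa [H] using hh)
  obtain ⟨δ, hδ, hball⟩ := Metric.isOpen_iff.1
    (isOpen_lt (NN.subset_CPWL k n hh).1 continuous_const) x₀ hx₀
  obtain ⟨R, hR, hsub⟩ := hsupp.isCompact.isBounded.subset_closedBall_lt 0 0
  have hr : 0 < 2 * R / δ := by positivity
  let A : (Fin n → ℝ) →ᵃ[ℝ] (Fin n → ℝ) :=
    (2 * R / δ) • (AffineMap.id ℝ _ - AffineMap.const ℝ _ x₀)
  let B : (Fin n → ℝ) →ᵃ[ℝ] (Fin n → ℝ) :=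
    (2 * R / δ)⁻¹ • AffineMap.id ℝ _ + AffineMap.const ℝ _ x₀
  have hAB (x) : A (B x) = x := by
    change (2 * R / δ) • ((2 * R / δ)⁻¹ • x + x₀ - x₀) = x
    rw [add_sub_cancel_right, smul_inv_smul₀ hr.ne']
  have hf₁ := NN.const_mul (NN.relu hh) (-1)
  have hf₂ := NN.comp_affine hfm A
  refine ⟨_, _, NN.subset_CPWL _ _ hf₁, NN.subset_CPWL _ _ hf₂, ⟨hf₁, Or.inr fun H => hrelu ?_⟩,
    ⟨hf₂, Or.inr fun H => hfn ?_⟩, fun x => ?_⟩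
  · simpa using NN.const_mul H (-1)
  · simpa [hAB] using NN.comp_affine H B
  · by_cases hx : dist x x₀ < δ
    · have hlt : h x < 0 := hball hx
      rw [max_eq_right hlt.le, mul_zero, max_eq_left (hneg _)]
    · have hzero : f (A x) = 0 := by
        by_contra hne
        have hle := hsub (subset_tsupport f hne)
        rw [mem_closedBall_zero_iff] at hle
        change ‖(2 * R / δ) • (x - x₀)‖ ≤ R at hle
        rw [norm_smul, Real.norm_of_nonneg hr.le, ← dist_eq_norm, div_mul_eq_mul_div,
          div_le_iff₀ hδ] at hle
        nlinarith
      rw [hzero, max_eq_right]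
      linarith [le_max_right (h x) 0]
end
end
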